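/- arXiv:1711.11208 — 2 statements merged into one kernel-verified Lean document; each statement's English description precedes it below -/
import Mathlib

section
/- Let A = (Q, Σ, →) be a labeled transition system and p₀, q₀ ∈ Q be infinitary ready trace equivalent processes (i.e., RT(p₀) = RT(q₀) and RT^∞(p₀) = RT^∞(q₀)). Then for every subset F ⊆ Σ, the weak fair languages of p₀ and q₀ with respect to F are equal: L^φ_F(p₀) = L^φ_F(q₀). -/
/-- A labeled transition system over states `Q` and alphabet `σ`. -/
structure LTS (Q σ : Type) where
  tr : Q → σ → Q → Prop

namespace LTS

variable {Q σ : Type}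

/-- Action `a` is enabled in process `p`. -/
def Enabled (A : LTS Q σ) (p : Q) (a : σ) : Prop := ∃ p', A.tr p a p'

/-- `FinRun A p l q` : there is a finite run from `p` to `q` with trace `l`. -/
inductive FinRun (A : LTS Q σ) : Q → List σ → Q → Prop
  | nil (p : Q) : FinRun A p [] p
  | cons {p p' q : Q} {a : σ} {l : List σ} :
      A.tr p a p' → FinRun A p' l q → FinRun A p (a :: l) q

/-- Traces of finite runs of `p`. -/
def FinTraces (A : LTS Q σ) (p : Q) : Set (List σ) := {l | ∃ q, A.FinRun p l q}

/-- An infinite run of `p` with state sequence `s` and label sequence `w`. -/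
def InfRun (A : LTS Q σ) (p : Q) (s : ℕ → Q) (w : ℕ → σ) : Prop :=
  s 0 = p ∧ ∀ i, A.tr (s i) (w i) (s (i + 1))

/-- Traces of infinite runs of `p`. -/
def InfTraces (A : LTS Q σ) (p : Q) : Set (ℕ → σ) := {w | ∃ s, A.InfRun p s w}

/-- An infinite run (given by states `s` and labels `w`) is strong fair w.r.t. `F`:
for every `a ∈ F`, if `a` is enabled in infinitely many states then `a` occurs
infinitely often among the labels. -/
def StrongFair (A : LTS Q σ) (F : Set σ) (s : ℕ → Q) (w : ℕ → σ) : Prop :=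
  ∀ a ∈ F, (∀ i, ∃ j, i ≤ j ∧ A.Enabled (s j) a) → (∀ i, ∃ j, i ≤ j ∧ w j = a)

/-- An infinite run is weak fair w.r.t. `F`: for every `a ∈ F`, if from some point
on `a` is always enabled, then `a` occurs infinitely often among the labels. -/
def WeakFair (A : LTS Q σ) (F : Set σ) (s : ℕ → Q) (w : ℕ → σ) : Prop :=
  ∀ a ∈ F, (∃ i, ∀ j, i ≤ j → A.Enabled (s j) a) → (∀ i, ∃ j, i ≤ j ∧ w j = a)

/-- The strong fair language of `p` w.r.t. `F`: all traces of finite runs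
(finite runs are always fair) together with all traces of strong fair infinite runs. -/
def SFairLang (A : LTS Q σ) (F : Set σ) (p : Q) : Set (List σ ⊕ (ℕ → σ)) :=
  fun x => Sum.elim (fun l => l ∈ A.FinTraces p)
    (fun w => ∃ s, A.InfRun p s w ∧ A.StrongFair F s w) x

/-- The weak fair language of `p` w.r.t. `F`: all traces of finite runs
(finite runs are always fair) together with all traces of weak fair infinite runs. -/
def WFairLang (A : LTS Q σ) (F : Set σ) (p : Q) : Set (List σ ⊕ (ℕ → σ)) :=
  fun x => Sum.elim (fun l => l ∈ A.FinTraces p)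
    (fun w => ∃ s, A.InfRun p s w ∧ A.WeakFair F s w) x

end LTS

namespace LTS

variable {Q σ : Type}

/-- `RTraceFrom A p l` : `l` is a finite ready trace of `p`, a word over `σ ⊕ Set σ`
where letters are transitions taken and sets are the ready sets (the sets of exactly
the enabled actions) of the current process. -/
inductive RTraceFrom (A : LTS Q σ) : Q → List (σ ⊕ Set σ) → Prop
  | nil (p : Q) : RTraceFrom A p []
  | act {p p' : Q} {a : σ} {l : List (σ ⊕ Set σ)} :
      A.tr p a p' → RTraceFrom A p' l → RTraceFrom A p (Sum.inl a :: l)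
  | ready {p : Q} {X : Set σ} {l : List (σ ⊕ Set σ)} :
      X = {a | A.Enabled p a} → RTraceFrom A p l → RTraceFrom A p (Sum.inr X :: l)

/-- The set of finite ready traces of `p`. -/
def RTraces (A : LTS Q σ) (p : Q) : Set (List (σ ⊕ Set σ)) := {l | A.RTraceFrom p l}

/-- The set of infinite ready traces of `p`. -/
def InfRTraces (A : LTS Q σ) (p : Q) : Set (ℕ → σ ⊕ Set σ) :=
  {w | ∃ s : ℕ → Q, s 0 = p ∧ ∀ i,
    (∃ a : σ, w i = Sum.inl a ∧ A.tr (s i) a (s (i + 1))) ∨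
    (∃ X : Set σ, w i = Sum.inr X ∧ s (i + 1) = s i ∧ X = {a | A.Enabled (s i) a})}

end LTS

namespace LTS

variable {Q σ : Type}

/-- The embedding of an action word into words over actions and ready sets yields a ready
trace exactly when the action word is a trace. -/
theorem rTraceFrom_map_inl_iff (A : LTS Q σ) (p : Q) (l : List σ) :
    A.RTraceFrom p (l.map Sum.inl) ↔ l ∈ A.FinTraces p := by
  induction l generalizing p with
  | nil => exact ⟨fun _ => ⟨p, .nil p⟩, fun _ => .nil p⟩
  | cons a l ih =>
    constructor
    · intro h
      cases h with
      | act ht hl =>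
        obtain ⟨q, hq⟩ := (ih _).1 hl
        exact ⟨q, .cons ht hq⟩
    · rintro ⟨q, h⟩
      cases h with
      | cons ht hl => exact .act ht ((ih _).2 ⟨q, hl⟩)

/-- The word that alternates between the ready sets `R i` and the actions `w i`. -/
def interleave (R : ℕ → Set σ) (w : ℕ → σ) (n : ℕ) : σ ⊕ Set σ :=
  if n % 2 = 0 then Sum.inr (R (n / 2)) else Sum.inl (w (n / 2))

theorem interleave_two_mul (R : ℕ → Set σ) (w : ℕ → σ) (i : ℕ) :
    interleave R w (2 * i) = Sum.inr (R i) := by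
  simp [interleave]

theorem interleave_two_mul_add_one (R : ℕ → Set σ) (w : ℕ → σ) (i : ℕ) :
    interleave R w (2 * i + 1) = Sum.inl (w i) := by
  have h₁ : (2 * i + 1) % 2 = 1 := by omega
  have h₂ : (2 * i + 1) / 2 = i := by omega
  simp [interleave, h₁, h₂]

/-- An alternating word is an infinite ready trace exactly when some infinite run has the given
actions as labels and the given sets as the ready sets of its states. -/
theorem interleave_mem_infRTraces_iff (A : LTS Q σ) (p : Q) (R : ℕ → Set σ) (w : ℕ → σ) :
    interleave R w ∈ A.InfRTraces p ↔
      ∃ s, A.InfRun p s w ∧ ∀ i, R i = {a | A.Enabled (s i) a} := by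
  constructor
  · rintro ⟨t, ht₀, ht⟩
    have hready (i : ℕ) : t (2 * i + 1) = t (2 * i) ∧ R i = {a | A.Enabled (t (2 * i)) a} := by
      rcases ht (2 * i) with ⟨a, ha, -⟩ | ⟨X, hX, hstay, hen⟩
      · simp [interleave_two_mul] at ha
      · rw [interleave_two_mul, Sum.inr.injEq] at hX
        exact ⟨hstay, hX.trans hen⟩
    refine ⟨fun i => t (2 * i), ⟨ht₀, fun i => ?_⟩, fun i => (hready i).2⟩
    rcases ht (2 * i + 1) with ⟨a, ha, htr⟩ | ⟨X, hX, -⟩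
    · rw [interleave_two_mul_add_one, Sum.inl.injEq] at ha
      rw [(hready i).1, ← ha] at htr
      exact htr
    · simp [interleave_two_mul_add_one] at hX
  · rintro ⟨s, ⟨hs₀, hs⟩, hR⟩
    refine ⟨fun n => s (n / 2), by simpa using hs₀, fun n => ?_⟩
    obtain ⟨i, rfl | rfl⟩ := n.even_or_odd'
    · refine .inr ⟨R i, interleave_two_mul R w i, congrArg s (by omega), ?_⟩
      simpa using hR i
    · refine .inl ⟨w i, interleave_two_mul_add_one R w i, ?_⟩
      have h₁ : (2 * i + 1) / 2 = i := by omega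
      have h₂ : (2 * i + 1 + 1) / 2 = i + 1 := by omega
      simpa only [h₁, h₂] using hs i

theorem WeakFair.of_enabled_imp {A : LTS Q σ} {F : Set σ} {s t : ℕ → Q} {w : ℕ → σ}
    (h : A.WeakFair F s w) (hst : ∀ i a, A.Enabled (t i) a → A.Enabled (s i) a) :
    A.WeakFair F t w :=
  fun a ha ⟨i, hi⟩ => h a ha ⟨i, fun j hj => hst j a (hi j hj)⟩

theorem wFairLang_subset_of_rTraces_subset (A : LTS Q σ) (F : Set σ) {p q : Q}
    (hfin : A.RTraces p ⊆ A.RTraces q) (hinf : A.InfRTraces p ⊆ A.InfRTraces q) :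
    A.WFairLang F p ⊆ A.WFairLang F q := by
  rintro (l | w) h
  · exact (rTraceFrom_map_inl_iff A q l).1 (hfin ((rTraceFrom_map_inl_iff A p l).2 h))
  · obtain ⟨s, hs, hfair⟩ := h
    obtain ⟨t, ht, hst⟩ := (interleave_mem_infRTraces_iff A q _ w).1
      (hinf ((interleave_mem_infRTraces_iff A p (fun i => {a | A.Enabled (s i) a}) w).2
        ⟨s, hs, fun _ => rfl⟩))
    exact ⟨t, ht, hfair.of_enabled_imp fun i a ha => (Set.ext_iff.1 (hst i) a).2 ha⟩

end LTS

/-- If `p₀` and `q₀` are infinitary ready trace equivalent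
(equal finite and infinite ready traces), then for every `F ⊆ Σ` their weak
fair languages w.r.t. `F` coincide. -/
theorem weakFairLang_eq_of_readyTraceEquiv {Q σ : Type} (A : LTS Q σ) (p₀ q₀ : Q)
    (hfin : A.RTraces p₀ = A.RTraces q₀)
    (hinf : A.InfRTraces p₀ = A.InfRTraces q₀) :
    ∀ F : Set σ, A.WFairLang F p₀ = A.WFairLang F q₀ :=
  fun F => (A.wFairLang_subset_of_rTraces_subset F hfin.le hinf.le).antisymm
    (A.wFairLang_subset_of_rTraces_subset F hfin.ge hinf.ge)
end

section
/- Let A = (Q, Σ, →) be a labeled transition system and p₀, q₀ ∈ Q be bisimilar processes. Then for every subset F ⊆ Σ, the weak fair languages of p₀ and q₀ with respect to F are equal: L^φ_F(p₀) = L^φ_F(q₀). -/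
namespace LTS

variable {Q σ : Type}

/-- `R` is a bisimulation on the LTS `A`. -/
def IsBisimulation (A : LTS Q σ) (R : Q → Q → Prop) : Prop :=
  ∀ p q, R p q →
    (∀ (a : σ) (p' : Q), A.tr p a p' → ∃ q', A.tr q a q' ∧ R p' q') ∧
    (∀ (a : σ) (q' : Q), A.tr q a q' → ∃ p', A.tr p a p' ∧ R p' q')

/-- `p` and `q` are bisimilar: some bisimulation relates them. -/
def Bisimilar (A : LTS Q σ) (p q : Q) : Prop :=
  ∃ R, A.IsBisimulation R ∧ R p q

end LTS

namespace LTS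

variable {Q σ : Type} {A : LTS Q σ} {R : Q → Q → Prop}

theorem IsBisimulation.swap (hR : A.IsBisimulation R) :
    A.IsBisimulation (Function.swap R) :=
  fun p q hpq => ⟨(hR q p hpq).2, (hR q p hpq).1⟩

theorem Bisimilar.symm {p q : Q} (h : A.Bisimilar p q) : A.Bisimilar q p := by
  obtain ⟨R, hR, hpq⟩ := h
  exact ⟨Function.swap R, hR.swap, hpq⟩

theorem IsBisimulation.enabled (hR : A.IsBisimulation R) {p q : Q} (hpq : R p q) {a : σ}
    (h : A.Enabled q a) : A.Enabled p a := by
  obtain ⟨q', hq'⟩ := h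
  obtain ⟨p', hp', -⟩ := (hR p q hpq).2 a q' hq'
  exact ⟨p', hp'⟩

theorem IsBisimulation.exists_finRun (hR : A.IsBisimulation R) {p p' : Q} {l : List σ}
    (hrun : A.FinRun p l p') : ∀ {q : Q}, R p q → ∃ q', A.FinRun q l q' ∧ R p' q' := by
  induction hrun with
  | nil p => exact fun {q} hpq => ⟨q, .nil q, hpq⟩
  | cons htr _ ih =>
    intro q hpq
    obtain ⟨q₁, hq₁, hR₁⟩ := (hR _ q hpq).1 _ _ htr
    obtain ⟨q', hq', hR'⟩ := ih hR₁
    exact ⟨q', .cons hq₁ hq', hR'⟩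

theorem IsBisimulation.exists_infRun (hR : A.IsBisimulation R) {p q : Q} (hpq : R p q)
    {s : ℕ → Q} {w : ℕ → σ} (hrun : A.InfRun p s w) :
    ∃ t, A.InfRun q t w ∧ ∀ i, R (s i) (t i) := by
  obtain ⟨rfl, hs⟩ := hrun
  choose next hnext using fun (i : ℕ) (x : {x // R (s i) x}) =>
    (hR (s i) x x.2).1 (w i) (s (i + 1)) (hs i)
  let t : (i : ℕ) → {x // R (s i) x} :=
    fun i => Nat.rec ⟨q, hpq⟩ (fun i x => ⟨next i x, (hnext i x).2⟩) i
  exact ⟨fun i => (t i).1, ⟨rfl, fun i => (hnext i (t i)).1⟩, fun i => (t i).2⟩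

theorem IsBisimulation.weakFair (hR : A.IsBisimulation R) {F : Set σ} {s t : ℕ → Q}
    {w : ℕ → σ} (hst : ∀ i, R (s i) (t i)) (hs : A.WeakFair F s w) : A.WeakFair F t w :=
  fun a ha ⟨i, hi⟩ => hs a ha ⟨i, fun j hj => hR.enabled (hst j) (hi j hj)⟩

theorem Bisimilar.wFairLang_subset {p q : Q} (h : A.Bisimilar p q) (F : Set σ) :
    A.WFairLang F p ⊆ A.WFairLang F q := by
  obtain ⟨R, hR, hpq⟩ := h
  rintro (l | w) hx
  · obtain ⟨p', hp'⟩ := hx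
    obtain ⟨q', hq', -⟩ := hR.exists_finRun hp' hpq
    exact ⟨q', hq'⟩
  · obtain ⟨s, hs, hfair⟩ := hx
    obtain ⟨t, ht, hst⟩ := hR.exists_infRun hpq hs
    exact ⟨t, ht, hR.weakFair hst hfair⟩

end LTS

/-- If `p₀` and `q₀` are bisimilar, then for every `F ⊆ Σ`
their weak fair languages w.r.t. `F` coincide. -/
theorem weakFairLang_eq_of_bisimilar {Q σ : Type} (A : LTS Q σ) (p₀ q₀ : Q)
    (h : A.Bisimilar p₀ q₀) :
    ∀ F : Set σ, A.WFairLang F p₀ = A.WFairLang F q₀ := by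
  exact fun F => (h.wFairLang_subset F).antisymm (h.symm.wFairLang_subset F)
end
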